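/- Under the assumptions of the CBA algorithm (rewards in [-1,1], zero-reward abstention action, η ∈ (0,1), initial weights w₁ ∈ ℝ₊^E with positive entries), for any u ∈ V the expected cumulative reward satisfies Σ_{t∈[T]} E[r_{t,a_t}] ≥ ρ(u) - Δ(u,w₁)/η - η(12K+2)T, where ρ(u) = Σ_t r_t · (Σ_i u_i e^i_t) and Δ is the unnormalized relative entropy. -/

import Mathlib

/-- The unnormalized relative entropy `Δ(u,v) = Σᵢ uᵢ ln(uᵢ/vᵢ) - ‖u‖₁ + ‖v‖₁`. -/
noncomputable def urel {E : ℕ} (u v : Fin E → ℝ) : ℝ :=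
  (∑ i, u i * Real.log (u i / v i)) - (∑ i, u i) + (∑ i, v i)

lemma cba_term_nonneg (u v : ℝ) (hu : 0 ≤ u) (hv : 0 < v) :
    0 ≤ u * Real.log (u / v) - u + v := by
  rcases hu.eq_or_lt with h | h
  · subst h; simp; exact hv.le
  · have h1 := Real.log_le_sub_one_of_pos (div_pos hv h)
    have h2 : Real.log (u / v) = - Real.log (v / u) := by
      rw [← Real.log_inv, inv_div]
    rw [h2]
    have h3 : u * Real.log (v / u) ≤ u * (v / u - 1) := mul_le_mul_of_nonneg_left h1 h.le
    have h4 : u * (v / u - 1) = v - u := by field_simp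
    linarith

lemma cba_urel_eq {E : ℕ} (u v : Fin E → ℝ) :
    urel u v = ∑ i, (u i * Real.log (u i / v i) - u i + v i) := by
  simp [urel, Finset.sum_add_distrib, Finset.sum_sub_distrib]

lemma cba_urel_nonneg {E : ℕ} (u v : Fin E → ℝ) (hu : ∀ i, 0 ≤ u i) (hv : ∀ i, 0 < v i) :
    0 ≤ urel u v := by
  rw [cba_urel_eq]
  exact Finset.sum_nonneg fun i _ => cba_term_nonneg _ _ (hu i) (hv i)

/-- three point identity -/
lemma cba_three {E : ℕ} (u v w : Fin E → ℝ) (hu : ∀ i, 0 ≤ u i) (hv : ∀ i, 0 < v i)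
    (hw : ∀ i, 0 < w i) :
    urel u w = urel u v + urel v w + ∑ i, (u i - v i) * Real.log (v i / w i) := by
  simp only [cba_urel_eq, ← Finset.sum_add_distrib]
  refine Finset.sum_congr rfl fun i _ => ?_
  rcases (hu i).eq_or_lt with h | h
  · rw [← h]; simp; ring
  · rw [Real.log_div h.ne' (hw i).ne', Real.log_div h.ne' (hv i).ne',
      Real.log_div (hv i).ne' (hw i).ne']
    ring

lemma cba_variational {E : ℕ} (x w p : Fin E → ℝ) (c : Fin E → ℝ)
    (hw : ∀ i, 0 < w i) (hx : ∀ i, 0 ≤ x i) (hxc : ∑ i, x i * c i ≤ 1)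
    (hmin : ∀ v : Fin E → ℝ, (∀ i, 0 ≤ v i) → ∑ i, v i * c i ≤ 1 → urel x w ≤ urel v w)
    (hpc : ∑ i, p i * c i ≤ 1) (l : ℝ) (hl0 : 0 < l) (hl1 : l ≤ 1)
    (hpos : ∀ i, 0 < x i + l * (p i - x i)) :
    0 ≤ ∑ i, (p i - x i) * Real.log ((x i + l * (p i - x i)) / w i) := by
  set v : Fin E → ℝ := fun i => x i + l * (p i - x i) with hv
  have h1 := hmin v (fun i => (hpos i).le) (by
    have : ∑ i, v i * c i = (1 - l) * ∑ i, x i * c i + l * ∑ i, p i * c i := by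
      rw [Finset.mul_sum, Finset.mul_sum, ← Finset.sum_add_distrib]
      exact Finset.sum_congr rfl fun i _ => by simp only [hv]; ring
    rw [this]
    nlinarith)
  have h2 := cba_three x v w hx hpos hw
  have h3 := cba_urel_nonneg x v hx hpos
  have h4 : ∑ i, (x i - v i) * Real.log (v i / w i)
      = -(l * ∑ i, (p i - x i) * Real.log (v i / w i)) := by
    rw [Finset.mul_sum, ← Finset.sum_neg_distrib]
    exact Finset.sum_congr rfl fun i _ => by simp only [hv]; ring
  have h5 : 0 ≤ l * ∑ i, (p i - x i) * Real.log (v i / w i) := by linarith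
  exact nonneg_of_mul_nonneg_right h5 hl0

lemma cba_proj_pos {E : ℕ} (x w : Fin E → ℝ) (c : Fin E → ℝ)
    (hc0 : ∀ i, 0 ≤ c i) (hc1 : ∀ i, c i ≤ 1)
    (hw : ∀ i, 0 < w i) (hx : ∀ i, 0 ≤ x i) (hxc : ∑ i, x i * c i ≤ 1)
    (hmin : ∀ v : Fin E → ℝ, (∀ i, 0 ≤ v i) → ∑ i, v i * c i ≤ 1 → urel x w ≤ urel v w)
    (j : Fin E) : 0 < x j := by
  by_contra hj
  have hj0 : x j = 0 := le_antisymm (not_lt.mp hj) (hx j)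
  have hE : (0 : ℝ) < E := by
    have := j.pos
    exact_mod_cast this
  set p : ℝ := 1 / E with hp
  have hp0 : 0 < p := by positivity
  have hpc : ∑ i, (fun _ => p) i * c i ≤ 1 := by
    calc ∑ i, p * c i ≤ ∑ i : Fin E, p * 1 :=
          Finset.sum_le_sum fun i _ => mul_le_mul_of_nonneg_left (hc1 i) hp0.le
      _ = 1 := by simp [hp, hE.ne']
  set C : ℝ := ∑ i, (p - x i) * Real.log (p / w i) with hC
  set l : ℝ := Real.exp (-((|C| + 1) / p)) with hl
  have hl0 : 0 < l := Real.exp_pos _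
  have hl1 : l ≤ 1 := by
    rw [hl, Real.exp_le_one_iff]
    have : 0 ≤ (|C| + 1) / p := by positivity
    linarith
  have hpos : ∀ i, 0 < x i + l * (p - x i) := by
    intro i
    have : 0 ≤ (1 - l) * x i := mul_nonneg (by linarith) (hx i)
    have : 0 < l * p := by positivity
    nlinarith
  have h1 := cba_variational x w (fun _ => p) c hw hx hxc hmin hpc l hl0 hl1 hpos
  have h2 : ∑ i, (p - x i) * Real.log ((x i + l * (p - x i)) / w i)
      ≤ ∑ i, ((p - x i) * Real.log (p / w i) + if i = j then p * Real.log l else 0) := by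
    refine Finset.sum_le_sum fun i _ => ?_
    by_cases hij : i = j
    · subst hij
      rw [if_pos rfl, hj0]
      have : (0 + l * (p - 0)) / w i = l * (p / w i) := by ring
      rw [this, Real.log_mul hl0.ne' (div_pos hp0 (hw i)).ne']
      linarith
    · rw [if_neg hij, add_zero]
      rcases le_total (x i) p with h | h
      · refine mul_le_mul_of_nonneg_left (Real.log_le_log (div_pos (hpos i) (hw i)) ?_)
          (by linarith)
        refine div_le_div_of_nonneg_right ?_ (hw i).le
        nlinarith
      · refine mul_le_mul_of_nonpos_left (Real.log_le_log (div_pos hp0 (hw i)) ?_)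
          (by linarith)
        refine div_le_div_of_nonneg_right ?_ (hw i).le
        nlinarith
  rw [Finset.sum_add_distrib, Finset.sum_ite_eq' Finset.univ j, if_pos (Finset.mem_univ j)] at h2
  have h3 : p * Real.log l = -(|C| + 1) := by
    rw [hl, Real.log_exp]; field_simp
  have h4 := le_abs_self C
  linarith

lemma cba_pyth {E : ℕ} (x w u : Fin E → ℝ) (c : Fin E → ℝ)
    (hw : ∀ i, 0 < w i) (hx : ∀ i, 0 < x i) (hxc : ∑ i, x i * c i ≤ 1)
    (hmin : ∀ v : Fin E → ℝ, (∀ i, 0 ≤ v i) → ∑ i, v i * c i ≤ 1 → urel x w ≤ urel v w)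
    (hu : ∀ i, 0 ≤ u i) (huc : ∑ i, u i * c i ≤ 1) : urel u x ≤ urel u w := by
  have h0 : 0 ≤ ∑ i, (u i - x i) * Real.log (x i / w i) := by
    have hcont : Filter.Tendsto
        (fun l : ℝ => ∑ i, (u i - x i) * Real.log ((x i + l * (u i - x i)) / w i))
        (nhdsWithin 0 (Set.Ioi 0)) (nhds (∑ i, (u i - x i) * Real.log (x i / w i))) := by
      refine tendsto_finsetSum _ fun i _ => ?_
      have : ContinuousAt
          (fun l : ℝ => (u i - x i) * Real.log ((x i + l * (u i - x i)) / w i)) 0 := by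
        refine ContinuousAt.mul continuousAt_const (ContinuousAt.log (by fun_prop) ?_)
        simpa using ⟨(hx i).ne', (hw i).ne'⟩
      have h := this.tendsto
      simp only [zero_mul, add_zero] at h
      exact h.mono_left nhdsWithin_le_nhds
    refine ge_of_tendsto hcont ?_
    have : Set.Ioo (0 : ℝ) 1 ∈ nhdsWithin (0 : ℝ) (Set.Ioi 0) :=
      Ioo_mem_nhdsGT one_pos
    filter_upwards [this] with l hl
    refine cba_variational x w u c hw (fun i => (hx i).le) hxc hmin huc l hl.1 hl.2.le fun i => ?_
    have h1 : 0 < (1 - l) * x i := mul_pos (by linarith [hl.2]) (hx i)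
    have h2 : 0 ≤ l * u i := mul_nonneg hl.1.le (hu i)
    nlinarith
  have h1 := cba_three u x w hu hx hw
  have h2 := cba_urel_nonneg x w (fun i => (hx i).le) hw
  linarith

lemma cba_update {E : ℕ} (x w' u g : Fin E → ℝ) (η : ℝ)
    (hη0 : 0 < η) (hη1 : η < 1) (hx : ∀ i, 0 < x i) (hu : ∀ i, 0 ≤ u i)
    (hg : ∀ i, g i ≤ 1) (hw' : ∀ i, w' i = x i * Real.exp (η * g i)) :
    urel u w' ≤ urel u x - η * ∑ i, (u i - x i) * g i + η ^ 2 * ∑ i, x i * g i ^ 2 := by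
  rw [cba_urel_eq, cba_urel_eq, Finset.mul_sum, Finset.mul_sum, ← Finset.sum_sub_distrib,
    ← Finset.sum_add_distrib]
  refine Finset.sum_le_sum fun i _ => ?_
  have hexp : Real.exp (η * g i) ≤ 1 + η * g i + (η * g i) ^ 2 := by
    have hle : η * g i ≤ 1 := by nlinarith [hg i]
    rcases le_total (-1) (η * g i) with h | h
    · have := Real.abs_exp_sub_one_sub_id_le (x := η * g i) (abs_le.mpr ⟨h, hle⟩)
      linarith [(abs_le.mp this).2]
    · have h1 : Real.exp (η * g i) ≤ 1 := Real.exp_le_one_iff.mpr (by linarith)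
      nlinarith
  have h1 : x i * Real.exp (η * g i) ≤ x i * (1 + η * g i + (η * g i) ^ 2) :=
    mul_le_mul_of_nonneg_left hexp (hx i).le
  have h2 : u i * Real.log (u i / w' i) = u i * Real.log (u i / x i) - u i * (η * g i) := by
    rcases (hu i).eq_or_lt with h | h
    · rw [← h]; simp
    · rw [hw' i, ← div_div, Real.log_div (div_pos h (hx i)).ne' (Real.exp_pos _).ne',
        Real.log_exp]
      ring
  rw [h2, hw' i]
  nlinarith

/-- the gradient estimate as a function of the weights and the action -/
noncomputable def cbaG {K E : ℕ} (e : Fin E → Fin K → ℝ) (r : Fin K → ℝ) (x : Fin E → ℝ)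
    (o : Option (Fin K)) (i : Fin E) : ℝ :=
  ∑ a, e i a * (1 - o.elim 0 (fun k => if a = k then (1 - r k) / (∑ j, x j * e j k) else 0))

lemma cbaG_none {K E : ℕ} (e : Fin E → Fin K → ℝ) (r : Fin K → ℝ) (x : Fin E → ℝ) (i : Fin E) :
    cbaG e r x none i = ∑ a, e i a := by
  simp [cbaG]

lemma cbaG_some {K E : ℕ} (e : Fin E → Fin K → ℝ) (r : Fin K → ℝ) (x : Fin E → ℝ) (k : Fin K)
    (i : Fin E) :
    cbaG e r x (some k) i = ∑ a, e i a - e i k * ((1 - r k) / (∑ j, x j * e j k)) := by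
  simp [cbaG, mul_sub]

lemma cbaG_le {K E : ℕ} (e : Fin E → Fin K → ℝ) (r : Fin K → ℝ) (x : Fin E → ℝ)
    (he0 : ∀ i a, 0 ≤ e i a) (hes : ∀ i, ∑ a, e i a ≤ 1) (hr : ∀ a, -1 ≤ r a ∧ r a ≤ 1)
    (hx : ∀ i, 0 ≤ x i) (o : Option (Fin K)) (i : Fin E) : cbaG e r x o i ≤ 1 := by
  cases o with
  | none => rw [cbaG_none]; exact hes i
  | some k =>
    rw [cbaG_some]
    have h1 : 0 ≤ ∑ j, x j * e j k := Finset.sum_nonneg fun j _ => mul_nonneg (hx j) (he0 j k)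
    have h2 : 0 ≤ e i k * ((1 - r k) / (∑ j, x j * e j k)) :=
      mul_nonneg (he0 i k) (div_nonneg (by linarith [(hr k).2]) h1)
    linarith [hes i]

lemma cba_trial {K E : ℕ} (e : Fin E → Fin K → ℝ) (r : Fin K → ℝ) (x u : Fin E → ℝ) (η : ℝ)
    (hη : 0 < η)
    (he0 : ∀ i a, 0 ≤ e i a) (he1 : ∀ i a, e i a ≤ 1)
    (hes : ∀ i, ∑ a, e i a ≤ 1) (hr : ∀ a, -1 ≤ r a ∧ r a ≤ 1)
    (hx : ∀ i, 0 < x i) (hxc : ∑ i, x i * ∑ a, e i a ≤ 1) :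
    ∑ o : Option (Fin K), o.elim (1 - ∑ a, ∑ i, x i * e i a) (fun k => ∑ i, x i * e i k) *
      ((∑ a, r a * ∑ i, u i * e i a) - o.elim 0 r - ∑ i, (u i - x i) * cbaG e r x o i
        + η * (∑ i, x i * cbaG e r x o i ^ 2 - (12 * (K : ℝ) + 2))) ≤ 0 := by
  set s : Fin K → ℝ := fun a => ∑ i, x i * e i a with hs
  set c : Fin E → ℝ := fun i => ∑ a, e i a with hc
  set ρ : ℝ := ∑ a, r a * ∑ i, u i * e i a with hρ
  have hs0 : ∀ a, 0 ≤ s a := fun a => Finset.sum_nonneg fun i _ => mul_nonneg (hx i).le (he0 i a)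
  have hc0 : ∀ i, 0 ≤ c i := fun i => Finset.sum_nonneg fun a _ => he0 i a
  have hS : ∑ a, s a = ∑ i, x i * c i := by
    simp only [hs, hc, Finset.mul_sum]; exact Finset.sum_comm
  have hS1 : ∑ a, s a ≤ 1 := hS ▸ hxc
  -- second moments
  have hYn : ∑ i, x i * cbaG e r x none i ^ 2 ≤ 2 := by
    have : ∑ i, x i * cbaG e r x none i ^ 2 ≤ ∑ i, x i * c i := by
      refine Finset.sum_le_sum fun i _ => mul_le_mul_of_nonneg_left ?_ (hx i).le
      rw [cbaG_none]
      have := hc0 i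
      have := hes i
      simp only [hc] at *
      nlinarith
    linarith
  have hYs : ∀ k, s k * ∑ i, x i * cbaG e r x (some k) i ^ 2 ≤ 2 * s k + 8 := by
    intro k
    rcases (hs0 k).eq_or_lt with h | h
    · rw [← h]; simp
    · set z := (1 - r k) / s k with hz
      have h1 : ∑ i, x i * cbaG e r x (some k) i ^ 2 ≤ ∑ i, (2 * (x i * c i) + 2 * z ^ 2 * (x i * e i k)) := by
        refine Finset.sum_le_sum fun i _ => ?_
        rw [cbaG_some]
        change x i * (c i - e i k * z) ^ 2 ≤ _
        have a1 : (c i - e i k * z) ^ 2 ≤ 2 * c i ^ 2 + 2 * (e i k * z) ^ 2 := by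
          nlinarith [sq_nonneg (c i + e i k * z)]
        have a2 : c i ^ 2 ≤ c i := by
          have := hc0 i
          have : c i ≤ 1 := hes i
          nlinarith
        have a3 : (e i k * z) ^ 2 ≤ z ^ 2 * e i k := by
          have : e i k ^ 2 ≤ e i k := by nlinarith [he0 i k, he1 i k]
          nlinarith [sq_nonneg z]
        have a4 : (c i - e i k * z) ^ 2 ≤ 2 * c i + 2 * (z ^ 2 * e i k) := by linarith
        calc _ ≤ x i * (2 * c i + 2 * (z ^ 2 * e i k)) :=
              mul_le_mul_of_nonneg_left a4 (hx i).le
          _ = _ := by ring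
      rw [Finset.sum_add_distrib, ← Finset.mul_sum, ← Finset.mul_sum] at h1
      change _ ≤ 2 * ∑ i, x i * c i + 2 * z ^ 2 * s k at h1
      have h2 : ∑ i, x i * cbaG e r x (some k) i ^ 2 ≤ 2 + 2 * z ^ 2 * s k := by linarith
      have h3 : s k * (2 + 2 * z ^ 2 * s k) = 2 * s k + 2 * (1 - r k) ^ 2 := by
        rw [hz]; field_simp
      have h4 : (1 - r k) ^ 2 ≤ 4 := by nlinarith [(hr k).1, (hr k).2]
      have := mul_le_mul_of_nonneg_left h2 h.le
      linarith
  -- first moments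
  set b : Fin K → ℝ := fun k => ∑ i, (u i - x i) * e i k with hb
  have hbe : ∀ k, b k = ∑ i, u i * e i k - s k := by
    intro k; simp only [hb, hs, sub_mul, Finset.sum_sub_distrib]
  set x0 : ℝ := ∑ i, (u i - x i) * c i with hx0
  have hx0b : x0 = ∑ k, b k := by
    simp only [hx0, hb, hc, Finset.mul_sum]; exact Finset.sum_comm
  have hXn : ∑ i, (u i - x i) * cbaG e r x none i = x0 := by
    simp only [cbaG_none, hx0, hc]
  have hXs : ∀ k, s k * ∑ i, (u i - x i) * cbaG e r x (some k) i = s k * x0 - b k * (1 - r k) := by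
    intro k
    have h1 : ∑ i, (u i - x i) * cbaG e r x (some k) i = x0 - b k * ((1 - r k) / s k) := by
      simp only [cbaG_some, mul_sub, Finset.sum_sub_distrib, hx0, hb, Finset.sum_mul, mul_assoc,
        hc, hs]
    rw [h1]
    rcases (hs0 k).eq_or_lt with h | h
    · have h2 : ∀ i, e i k = 0 := by
        intro i
        have := (Finset.sum_eq_zero_iff_of_nonneg
          (fun i _ => mul_nonneg (hx i).le (he0 i k))).mp h.symm i (Finset.mem_univ i)
        rcases mul_eq_zero.mp this with h' | h'
        · exact absurd h' (hx i).ne'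
        · exact h'
      have h3 : b k = 0 := by simp [hb, h2]
      rw [← h, h3]; simp
    · field_simp
  rw [Fintype.sum_option]
  simp only [Option.elim_none, Option.elim_some, hXn]
  set N : ℝ := 12 * (K : ℝ) + 2 with hN
  have key : ∀ k, s k * (ρ - r k - ∑ i, (u i - x i) * cbaG e r x (some k) i
        + η * (∑ i, x i * cbaG e r x (some k) i ^ 2 - N))
      ≤ s k * (ρ - x0 + η * (2 - N)) + (b k * (1 - r k) - s k * r k + η * 8) := by
    intro k
    have h1 := hXs k
    have h2 := mul_le_mul_of_nonneg_left (hYs k) hη.le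
    linear_combination h2 - h1
  have hsum := Finset.sum_le_sum fun k (_ : k ∈ Finset.univ) => key k
  rw [Finset.sum_add_distrib, ← Finset.sum_mul, Finset.sum_add_distrib, Finset.sum_const,
    Finset.card_univ, Fintype.card_fin, nsmul_eq_mul] at hsum
  have hlin : ∑ k, (b k * (1 - r k) - s k * r k) = x0 - ρ := by
    rw [hx0b, hρ, ← Finset.sum_sub_distrib]
    refine Finset.sum_congr rfl fun k _ => ?_
    have := hbe k
    linear_combination (-r k) * this
  rw [hlin] at hsum
  have hnone : (1 - ∑ a, s a) * (ρ - 0 - x0 + η * (∑ i, x i * cbaG e r x none i ^ 2 - N))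
      ≤ (1 - ∑ a, s a) * (ρ - x0 + η * (2 - N)) := by
    refine mul_le_mul_of_nonneg_left ?_ (by linarith)
    have := mul_le_mul_of_nonneg_left hYn hη.le
    linarith
  have hK : 0 ≤ η * K := by positivity
  rw [hN] at *
  linear_combination hsum + hnone + 4 * hK

section paths
variable {T K : ℕ}

lemma cba_sum_update (n : Fin T) (F : (Fin T → Option (Fin K)) → ℝ) :
    ∑ ω, ∑ o, F (Function.update ω n o) = ((K : ℝ) + 1) * ∑ ω, F ω := by
  have : ∑ ω : Fin T → Option (Fin K), ∑ o, F (Function.update ω n o)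
      = ∑ ω : Fin T → Option (Fin K), ∑ _o : Option (Fin K), F ω := by
    rw [← Fintype.sum_prod_type', ← Fintype.sum_prod_type']
    let φ : (Fin T → Option (Fin K)) × Option (Fin K) → (Fin T → Option (Fin K)) × Option (Fin K) :=
      fun p => (Function.update p.1 n p.2, p.1 n)
    have hφ : Function.Involutive φ := by
      rintro ⟨ω, o⟩
      simp [φ]
    exact Fintype.sum_equiv hφ.toPerm _ _ (fun p => rfl)
  rw [this, Finset.mul_sum]
  simp

/-- partial path weight: the product over the first `n` trials -/
def cbaP (q : (Fin T → Option (Fin K)) → Fin T → Option (Fin K) → ℝ) (n : ℕ)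
    (ω : Fin T → Option (Fin K)) : ℝ :=
  ∏ t : Fin T, if t.1 < n then q ω t (ω t) else 1

lemma cbaP_update (q : (Fin T → Option (Fin K)) → Fin T → Option (Fin K) → ℝ)
    (hq : ∀ ω ω' (t : Fin T), (∀ t' : Fin T, t' < t → ω t' = ω' t') → q ω t = q ω' t)
    (n : Fin T) (ω : Fin T → Option (Fin K)) (o : Option (Fin K)) :
    cbaP q (n.1 + 1) (Function.update ω n o) = cbaP q n.1 ω * q ω n o := by
  have : q ω n o = ∏ t : Fin T, if t = n then q ω n o else 1 := by simp
  rw [this, cbaP, cbaP, ← Finset.prod_mul_distrib]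
  refine Finset.prod_congr rfl fun t _ => ?_
  have hqt : t ≤ n → q (Function.update ω n o) t = q ω t := fun htn =>
    hq _ _ t fun t' ht' => Function.update_of_ne (ht'.trans_le htn).ne _ _
  rcases lt_trichotomy t n with h | h | h
  · have h1 : t.1 < n.1 := h
    rw [if_pos (by omega), if_pos h1, if_neg h.ne, hqt h.le, Function.update_of_ne h.ne, mul_one]
  · subst h
    simp [hqt le_rfl]
  · have h1 : n.1 < t.1 := h
    rw [if_neg (by omega), if_neg (by omega), if_neg h.ne', mul_one]

lemma cba_step (q : (Fin T → Option (Fin K)) → Fin T → Option (Fin K) → ℝ)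
    (hq : ∀ ω ω' (t : Fin T), (∀ t' : Fin T, t' < t → ω t' = ω' t') → q ω t = q ω' t)
    (n : Fin T) (f : (Fin T → Option (Fin K)) → ℝ) :
    ((K : ℝ) + 1) * ∑ ω, cbaP q (n.1 + 1) ω * f ω
      = ∑ ω, cbaP q n.1 ω * ∑ o, q ω n o * f (Function.update ω n o) := by
  rw [← cba_sum_update n]
  refine Finset.sum_congr rfl fun ω _ => ?_
  rw [Finset.mul_sum]
  refine Finset.sum_congr rfl fun o _ => ?_
  rw [cbaP_update q hq]; ring

lemma cbaP_full (q : (Fin T → Option (Fin K)) → Fin T → Option (Fin K) → ℝ)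
    (ω : Fin T → Option (Fin K)) : cbaP q T ω = ∏ t, q ω t (ω t) := by
  simp [cbaP]

lemma cba_total (q : (Fin T → Option (Fin K)) → Fin T → Option (Fin K) → ℝ)
    (hq : ∀ ω ω' (t : Fin T), (∀ t' : Fin T, t' < t → ω t' = ω' t') → q ω t = q ω' t)
    (hq1 : ∀ ω t, ∑ o, q ω t o = 1) : ∑ ω, ∏ t, q ω t (ω t) = 1 := by
  have h : ∀ n, n ≤ T → ((K : ℝ) + 1) ^ n * ∑ ω, cbaP q n ω = ((K : ℝ) + 1) ^ T := by
    intro n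
    induction n with
    | zero => intro _; simp [cbaP]
    | succ n ih =>
      intro hn
      have h1 := cba_step q hq ⟨n, hn⟩ (fun _ => 1)
      simp only [mul_one, hq1] at h1
      rw [pow_succ, mul_assoc, h1]
      exact ih (by omega)
  have h1 := h T le_rfl
  simp only [cbaP_full] at h1
  have : ((K : ℝ) + 1) ^ T ≠ 0 := by positivity
  exact (mul_eq_left₀ this).mp h1

lemma cba_cond (q : (Fin T → Option (Fin K)) → Fin T → Option (Fin K) → ℝ)
    (hq : ∀ ω ω' (t : Fin T), (∀ t' : Fin T, t' < t → ω t' = ω' t') → q ω t = q ω' t)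
    (hq0 : ∀ ω t o, 0 ≤ q ω t o)
    (hq1 : ∀ ω t, ∑ o, q ω t o = 1) (t : Fin T)
    (F : (Fin T → Option (Fin K)) → Option (Fin K) → ℝ)
    (hF : ∀ ω ω', (∀ t' : Fin T, t' < t → ω t' = ω' t') → F ω = F ω')
    (hle : ∀ ω, ∑ o, q ω t o * F ω o ≤ 0) :
    ∑ ω, (∏ t, q ω t (ω t)) * F ω (ω t) ≤ 0 := by
  have hK : (0 : ℝ) < (K : ℝ) + 1 := by positivity
  have h : ∀ n, t.1 + 1 ≤ n → n ≤ T → ∑ ω, cbaP q n ω * F ω (ω t) ≤ 0 := by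
    intro n hn
    induction n, hn using Nat.le_induction with
    | base =>
      intro _
      refine nonpos_of_mul_nonpos_right ?_ hK
      rw [cba_step q hq t]
      refine Finset.sum_nonpos fun ω _ => mul_nonpos_of_nonneg_of_nonpos ?_ ?_
      · unfold cbaP
        refine Finset.prod_nonneg fun t' _ => ?_
        split_ifs
        · exact hq0 _ _ _
        · exact zero_le_one
      · refine le_of_eq_of_le (Finset.sum_congr rfl fun o _ => ?_) (hle ω)
        rw [hF (Function.update ω t o) ω
          (fun t' ht' => Function.update_of_ne ht'.ne _ _), Function.update_self]
    | succ n hn ih =>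
      intro hnT
      refine nonpos_of_mul_nonpos_right ?_ hK
      have h1 := cba_step q hq ⟨n, hnT⟩ (fun ω => F ω (ω t))
      simp only at h1
      rw [h1]
      refine le_of_eq_of_le (Finset.sum_congr rfl fun ω _ => ?_) (ih (by omega))
      congr 1
      have htn : t < (⟨n, hnT⟩ : Fin T) := by
        rw [Fin.lt_def]; exact hn
      have h2 : ∀ o, F (Function.update ω ⟨n, hnT⟩ o) (Function.update ω ⟨n, hnT⟩ o t)
          = F ω (ω t) := by
        intro o
        rw [hF (Function.update ω ⟨n, hnT⟩ o) ω
          (fun t' ht' => Function.update_of_ne (ht'.trans htn).ne _ _),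
          Function.update_of_ne htn.ne]
      simp only [h2]
      rw [← Finset.sum_mul, hq1, one_mul]
  have := h T t.2 le_rfl
  simpa only [cbaP_full] using this

end paths

/-- Theorem 1 (reward bound of CBA). The sample space is `Ω = Fin T → Option (Fin K)`,
a full sequence of chosen actions (`none` = abstention). The algorithm is described by
adapted processes: weights `w ω t`, their `Δ`-projections `w̃ ω t` onto
`Vₜ = {v ≥ 0 : Σᵢ vᵢ cₜᵢ ≤ 1}` (where `cₜᵢ = ‖eⁱₜ‖₁`), the played stochastic action
`s ω t = Σᵢ w̃ᵢ eⁱₜ`, the importance-weighted reward estimate `rh`, the exponential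
weight update, and the induced path probability `P`. For any `u` in the valid set `V`,
the expected cumulative reward is at least `ρ(u) - Δ(u,w₁)/η - η(12K+2)T`. -/
theorem stmt_13 (T K E : ℕ)
    (e : Fin T → Fin E → Fin K → ℝ) (r : Fin T → Fin K → ℝ)
    (he0 : ∀ t i a, 0 ≤ e t i a) (he1 : ∀ t i a, e t i a ≤ 1)
    (hes : ∀ t i, ∑ a, e t i a ≤ 1)
    (hr : ∀ t a, -1 ≤ r t a ∧ r t a ≤ 1)
    (η : ℝ) (hη0 : 0 < η) (hη1 : η < 1)
    (w1 : Fin E → ℝ) (hw1 : ∀ i, 0 < w1 i)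
    -- the algorithm's processes
    (w : (Fin T → Option (Fin K)) → ℕ → Fin E → ℝ)
    (wt : (Fin T → Option (Fin K)) → Fin T → Fin E → ℝ)
    (s : (Fin T → Option (Fin K)) → Fin T → Fin K → ℝ)
    (rh : (Fin T → Option (Fin K)) → Fin T → Fin K → ℝ)
    (P : (Fin T → Option (Fin K)) → ℝ)
    -- initial weights
    (hw0 : ∀ ω, w ω 0 = w1)
    -- adaptedness: weights at trial t depend only on actions before trial t
    (hadapt : ∀ ω ω' (t : Fin T), (∀ t' : Fin T, t' < t → ω t' = ω' t') →
      w ω t.1 = w ω' t.1 ∧ wt ω t = wt ω' t)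
    -- projection step: w̃ₜ is the Δ-projection of wₜ onto Vₜ
    (hproj : ∀ ω (t : Fin T),
      ((∀ i, 0 ≤ wt ω t i) ∧ ∑ i, wt ω t i * ∑ a, e t i a ≤ 1) ∧
      ∀ v : Fin E → ℝ, (∀ i, 0 ≤ v i) → (∑ i, v i * ∑ a, e t i a ≤ 1) →
        urel (wt ω t) (w ω t.1) ≤ urel v (w ω t.1))
    -- the played stochastic action
    (hs : ∀ ω (t : Fin T) a, s ω t a = ∑ i, wt ω t i * e t i a)
    -- the importance-weighted reward estimate (equals 1 on abstention)
    (hrh : ∀ ω (t : Fin T) a, rh ω t a =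
      1 - (ω t).elim 0 (fun k => if a = k then (1 - r t k) / s ω t k else 0))
    -- exponential weight update
    (hupd : ∀ ω (t : Fin T) i,
      w ω (t.1 + 1) i = wt ω t i * Real.exp (η * ∑ a, e t i a * rh ω t a))
    -- path probability: product of per-trial action probabilities
    (hP : ∀ ω, P ω = ∏ t : Fin T, (ω t).elim (1 - ∑ a, s ω t a) (fun k => s ω t k))
    -- any valid linear combination of experts
    (u : Fin E → ℝ) (hu0 : ∀ i, 0 ≤ u i)
    (huV : ∀ t : Fin T, ∑ i, u i * ∑ a, e t i a ≤ 1) :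
    ∑ ω : Fin T → Option (Fin K), P ω * (∑ t : Fin T, (ω t).elim 0 (fun k => r t k))
      ≥ (∑ t : Fin T, ∑ a, r t a * ∑ i, u i * e t i a)
        - urel u w1 / η - η * (12 * (K : ℝ) + 2) * T := by
  have hc0 : ∀ t i, 0 ≤ ∑ a, e t i a := fun t i => Finset.sum_nonneg fun a _ => he0 t i a
  have hg : ∀ ω (t : Fin T) i,
      ∑ a, e t i a * rh ω t a = cbaG (e t) (r t) (wt ω t) (ω t) i := by
    intro ω t i
    simp only [cbaG, hrh, hs]
  have hstep : ∀ ω (t : Fin T), (∀ i, 0 < w ω t.1 i) → ∀ i, 0 < wt ω t i := by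
    intro ω t hw i
    exact cba_proj_pos (wt ω t) (w ω t.1) (fun i => ∑ a, e t i a) (hc0 t) (hes t) hw
      (hproj ω t).1.1 (hproj ω t).1.2 (hproj ω t).2 i
  have hwpos : ∀ ω n, n ≤ T → ∀ i, 0 < w ω n i := by
    intro ω n
    induction n with
    | zero => intro _ i; rw [hw0]; exact hw1 i
    | succ n ih =>
      intro hn i
      rw [hupd ω ⟨n, hn⟩ i]
      exact mul_pos (hstep ω ⟨n, hn⟩ (ih (by omega)) i) (Real.exp_pos _)
  have hwtpos : ∀ ω (t : Fin T) i, 0 < wt ω t i := fun ω t =>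
    hstep ω t (hwpos ω t.1 t.2.le)
  set X : (Fin T → Option (Fin K)) → Fin T → ℝ := fun ω t =>
    ∑ i, (u i - wt ω t i) * cbaG (e t) (r t) (wt ω t) (ω t) i with hX
  set Y : (Fin T → Option (Fin K)) → Fin T → ℝ := fun ω t =>
    ∑ i, wt ω t i * cbaG (e t) (r t) (wt ω t) (ω t) i ^ 2 with hY
  have hone : ∀ ω (t : Fin T),
      η * X ω t - η ^ 2 * Y ω t ≤ urel u (w ω t.1) - urel u (w ω (t.1 + 1)) := by
    intro ω t
    have h1 := cba_pyth (wt ω t) (w ω t.1) u (fun i => ∑ a, e t i a) (hwpos ω t.1 t.2.le)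
      (hwtpos ω t) (hproj ω t).1.2 (hproj ω t).2 hu0 (huV t)
    have h2 := cba_update (wt ω t) (w ω (t.1 + 1)) u (cbaG (e t) (r t) (wt ω t) (ω t)) η hη0 hη1
      (hwtpos ω t) hu0
      (cbaG_le (e t) (r t) (wt ω t) (he0 t) (hes t) (hr t) (fun i => (hwtpos ω t i).le) (ω t))
      (fun i => by rw [hupd ω t i, hg])
    simp only [hX, hY]
    linarith
  have hpath : ∀ ω, ∑ t, (X ω t - η * Y ω t) ≤ urel u w1 / η := by
    intro ω
    have h1 : ∑ t : Fin T, (η * X ω t - η ^ 2 * Y ω t)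
        ≤ ∑ t : Fin T, (urel u (w ω t.1) - urel u (w ω (t.1 + 1))) :=
      Finset.sum_le_sum fun t _ => hone ω t
    rw [Fin.sum_univ_eq_sum_range (fun n => urel u (w ω n) - urel u (w ω (n + 1))),
      Finset.sum_range_sub', hw0] at h1
    have h2 := cba_urel_nonneg u (w ω T) hu0 (hwpos ω T le_rfl)
    rw [le_div_iff₀ hη0, Finset.sum_mul]
    have h3 : ∑ t, (X ω t - η * Y ω t) * η = ∑ t : Fin T, (η * X ω t - η ^ 2 * Y ω t) :=
      Finset.sum_congr rfl fun t _ => by ring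
    rw [h3]
    linarith
  -- the conditional action probabilities
  set q : (Fin T → Option (Fin K)) → Fin T → Option (Fin K) → ℝ := fun ω t o =>
    o.elim (1 - ∑ a, ∑ i, wt ω t i * e t i a) (fun k => ∑ i, wt ω t i * e t i k) with hqdef
  have hq : ∀ ω ω' (t : Fin T), (∀ t' : Fin T, t' < t → ω t' = ω' t') → q ω t = q ω' t := by
    intro ω ω' t h
    simp only [hqdef, (hadapt ω ω' t h).2]
  have hq0 : ∀ ω t o, 0 ≤ q ω t o := by
    intro ω t o
    cases o with
    | none =>
      have h1 : ∑ a, ∑ i, wt ω t i * e t i a = ∑ i, wt ω t i * ∑ a, e t i a := by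
        simp only [Finset.mul_sum]; exact Finset.sum_comm
      simp only [hqdef, Option.elim_none, h1]
      linarith [(hproj ω t).1.2]
    | some k =>
      exact Finset.sum_nonneg fun i _ => mul_nonneg (hwtpos ω t i).le (he0 t i k)
  have hq1 : ∀ ω t, ∑ o, q ω t o = 1 := by
    intro ω t
    rw [Fintype.sum_option]
    simp [hqdef]
  have hPq : ∀ ω, P ω = ∏ t, q ω t (ω t) := by
    intro ω
    rw [hP]
    simp only [hqdef, hs]
  have hP0 : ∀ ω, 0 ≤ P ω := fun ω => by
    rw [hPq]; exact Finset.prod_nonneg fun t _ => hq0 _ _ _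
  have hP1 : ∑ ω, P ω = 1 := by
    simp only [hPq]; exact cba_total q hq hq1
  set ρ : Fin T → ℝ := fun t => ∑ a, r t a * ∑ i, u i * e t i a with hρ
  have hexp : ∀ t : Fin T, ∑ ω, P ω * (ρ t - (ω t).elim 0 (r t) - X ω t
      + η * (Y ω t - (12 * (K : ℝ) + 2))) ≤ 0 := by
    intro t
    have h := cba_cond q hq hq0 hq1 t
      (fun ω o => ρ t - o.elim 0 (r t) - ∑ i, (u i - wt ω t i) * cbaG (e t) (r t) (wt ω t) o i
        + η * (∑ i, wt ω t i * cbaG (e t) (r t) (wt ω t) o i ^ 2 - (12 * (K : ℝ) + 2)))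
      (fun ω ω' h => by simp only [(hadapt ω ω' t h).2])
      (fun ω => cba_trial (e t) (r t) (wt ω t) u η hη0 (he0 t) (he1 t) (hes t) (hr t)
        (hwtpos ω t) (hproj ω t).1.2)
    simp only [hPq]
    exact h
  have hA : ∑ t : Fin T, ∑ ω, P ω * (ρ t - (ω t).elim 0 (r t) - X ω t
      + η * (Y ω t - (12 * (K : ℝ) + 2))) ≤ 0 := Finset.sum_nonpos fun t _ => hexp t
  rw [Finset.sum_comm] at hA
  have hB : ∀ ω, P ω * (∑ t, ρ t - urel u w1 / η - η * (12 * (K : ℝ) + 2) * T)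
      - P ω * (∑ t : Fin T, (ω t).elim 0 (fun k => r t k))
      ≤ ∑ t : Fin T, P ω * (ρ t - (ω t).elim 0 (r t) - X ω t
      + η * (Y ω t - (12 * (K : ℝ) + 2))) := by
    intro ω
    have h1 : ∑ t : Fin T, P ω * (ρ t - (ω t).elim 0 (r t) - X ω t
        + η * (Y ω t - (12 * (K : ℝ) + 2)))
        = P ω * (∑ t, ρ t - (∑ t : Fin T, (ω t).elim 0 (fun k => r t k))
          - ∑ t, (X ω t - η * Y ω t) - η * (12 * (K : ℝ) + 2) * T) := by
      have h2 : η * (12 * (K : ℝ) + 2) * T = ∑ t : Fin T, η * (12 * (K : ℝ) + 2) := by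
        simp; ring
      rw [← Finset.mul_sum, h2, ← Finset.sum_sub_distrib, ← Finset.sum_sub_distrib,
        ← Finset.sum_sub_distrib]
      congr 1
      exact Finset.sum_congr rfl fun t _ => by ring
    rw [h1, ← mul_sub]
    exact mul_le_mul_of_nonneg_left (by linarith [hpath ω]) (hP0 ω)
  have hC := (Finset.sum_le_sum fun ω (_ : ω ∈ Finset.univ) => hB ω).trans hA
  rw [Finset.sum_sub_distrib, ← Finset.sum_mul, hP1, one_mul] at hC
  linarith
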